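/- Let m ∈ ℤ_{>0}^r and m′ ∈ ℤ_{>0}^{r′} be weakly decreasing tuples of positive integers with r, r′ ≥ 2, let a, a′ ∈ {0,1}, and assume (a, m) ≠ (1, (1,1)) and (a′, m′) ≠ (1, (1,1)). If the quivers Ξ_a(m) and Ξ_{a′}(m′) are isomorphic, then a = a′, r = r′ and m = m′. -/

import Mathlib

/-- Vertices of `Ξ_a(m)` : points `x ∈ ℕ^r` with `x ≤ m` coordinatewise and `|x| ≡ a (mod 2)`. -/
def xiVert {r : ℕ} (m : Fin r → ℕ) (a : ℕ) (x : Fin r → ℕ) : Prop :=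
  (∀ i, x i ≤ m i) ∧ (∑ i, x i) % 2 = a

/-- Arrows of `Ξ(m)` : `x ← x + 2e_j` when `x j + 2 ≤ m j`, and `x ← x + e_i + e_j` when
`i < j`, `x i + 1 ≤ m i` and `x j + 1 ≤ m j`. -/
def xiArrow {r : ℕ} (m : Fin r → ℕ) (x y : Fin r → ℕ) : Prop :=
  (∃ j, x j + 2 ≤ m j ∧ y = x + Pi.single j 2) ∨
    (∃ i j, i < j ∧ x i + 1 ≤ m i ∧ x j + 1 ≤ m j ∧ y = x + Pi.single i 1 + Pi.single j 1)

open Finset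

/-- Elements of size two below `x`. -/
def xiT {r : ℕ} (x : Fin r → ℕ) : Finset (Fin r → ℕ) :=
  (Finset.Iic x).filter (fun z => ∑ i, z i = 2)

lemma xi_eq_single {r : ℕ} (z : Fin r → ℕ) (i : Fin r) (n : ℕ) (h : ∑ k, z k = n) (hi : n ≤ z i) :
    z = Pi.single i n := by
  have h1 : ∑ k ∈ univ.erase i, z k + z i = ∑ k, z k := Finset.sum_erase_add _ _ (mem_univ i)
  have h2 : ∑ k ∈ univ.erase i, z k = 0 := by omega
  rw [Finset.sum_eq_zero_iff] at h2
  funext k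
  by_cases hk : k = i
  · subst hk; simp; omega
  · simp [hk, h2 k (by simp [hk])]

lemma xi_le_one {r : ℕ} (z : Fin r → ℕ) (h : ∀ i, z i ≤ 1) :
    ∑ k, z k = (univ.filter (fun i => 1 ≤ z i)).card := by
  rw [Finset.card_filter]
  refine Finset.sum_congr rfl fun i _ => ?_
  have := h i
  split_ifs <;> omega

lemma xi_ind {r : ℕ} (z : Fin r → ℕ) (h : ∀ i, z i ≤ 1) :
    z = fun k => if k ∈ univ.filter (fun i => 1 ≤ z i) then 1 else 0 := by
  funext k
  have := h k
  simp only [mem_filter, mem_univ, true_and]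
  split_ifs <;> omega

lemma xi_two {r : ℕ} (z : Fin r → ℕ) (h : ∑ k, z k = 2) :
    (∃ i, z = Pi.single i 2) ∨ ∃ s : Finset (Fin r), s.card = 2 ∧ (∀ i ∈ s, 1 ≤ z i) ∧
      z = fun k => if k ∈ s then 1 else 0 := by
  by_cases hz : ∃ i, 2 ≤ z i
  · obtain ⟨i, hi⟩ := hz
    exact Or.inl ⟨i, xi_eq_single z i 2 h hi⟩
  · push Not at hz
    have hz' : ∀ i, z i ≤ 1 := fun i => by have := hz i; omega
    right
    refine ⟨univ.filter (fun i => 1 ≤ z i), ?_, ?_, xi_ind z hz'⟩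
    · rw [← xi_le_one z hz', h]
    · simp

lemma xiT_card {r : ℕ} (x : Fin r → ℕ) :
    (xiT x).card = (univ.filter (fun i => 2 ≤ x i)).card
      + (univ.filter (fun i => 1 ≤ x i)).card.choose 2 := by
  classical
  have key : xiT x = (univ.filter (fun i => 2 ≤ x i)).image (fun i => (Pi.single i 2 : Fin r → ℕ))
      ∪ (powersetCard 2 (univ.filter (fun i => 1 ≤ x i))).image
        (fun s => fun k => if k ∈ s then 1 else 0) := by
    ext z
    simp only [xiT, mem_filter, mem_Iic, mem_union, mem_image, mem_powersetCard, mem_univ, true_and]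
    constructor
    · rintro ⟨hz, h2⟩
      rcases xi_two z h2 with ⟨i, rfl⟩ | ⟨s, hs, hs1, hzs⟩
      · left
        exact ⟨i, by simpa using hz i, rfl⟩
      · right
        refine ⟨s, ⟨fun i hi => ?_, hs⟩, hzs.symm⟩
        simp only [mem_filter, mem_univ, true_and]
        exact (hs1 i hi).trans (hz i)
    · rintro (⟨i, hi, rfl⟩ | ⟨s, ⟨hs, hc⟩, rfl⟩)
      · refine ⟨fun k => ?_, by simp⟩
        by_cases hk : k = i
        · subst hk; simpa using hi
        · simp [hk]
      · refine ⟨fun k => ?_, by simp [hc]⟩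
        by_cases hk : k ∈ s
        · have := hs hk
          simp only [mem_filter, mem_univ, true_and] at this
          simpa [hk] using this
        · simp [hk]
  rw [key, card_union_of_disjoint, card_image_of_injective, card_image_of_injective,
    card_powersetCard]
  · intro s t hst
    ext k
    have := congrFun hst k
    by_cases h1 : k ∈ s <;> by_cases h2 : k ∈ t <;> simp_all
  · intro i j hij
    have := congrFun hij i
    by_contra hne
    simp [Pi.single_apply, hne] at this
  · rw [Finset.disjoint_left]
    intro z hz hz'
    simp only [mem_image] at hz hz'
    obtain ⟨i, _, rfl⟩ := hz
    obtain ⟨s, _, hs⟩ := hz'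
    have := congrFun hs i
    simp at this
    split_ifs at this <;> omega

lemma xiArrow_iff {r : ℕ} (m x y : Fin r → ℕ) (hy : ∀ i, y i ≤ m i) :
    xiArrow m x y ↔ ∃ z : Fin r → ℕ, ∑ i, z i = 2 ∧ y = x + z := by
  constructor
  · rintro (⟨j, _, h⟩ | ⟨i, j, _, _, _, h⟩)
    · exact ⟨_, by simp, h⟩
    · exact ⟨Pi.single i 1 + Pi.single j 1, by simp [Finset.sum_add_distrib], by rw [h, add_assoc]⟩
  · rintro ⟨z, hz, rfl⟩
    rcases xi_two z hz with ⟨i, rfl⟩ | ⟨s, hs, -, rfl⟩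
    · left
      exact ⟨i, by simpa using hy i, rfl⟩
    · right
      have aux : ∀ i j : Fin r, i < j → s = {i, j} → ∃ i j, i < j ∧ x i + 1 ≤ m i ∧ x j + 1 ≤ m j ∧
          (x + fun k => if k ∈ s then 1 else 0) = x + Pi.single i 1 + Pi.single j 1 := by
        rintro i j hij rfl
        refine ⟨i, j, hij, by simpa using hy i, by simpa using hy j, ?_⟩
        rw [add_assoc]
        congr 1
        funext k
        simp only [mem_insert, mem_singleton, Pi.add_apply, Pi.single_apply]
        by_cases h1 : k = i
        · subst h1; simp [hij.ne]
        · simp [h1]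
      obtain ⟨i, j, hne, rfl⟩ := Finset.card_eq_two.1 hs
      rcases lt_or_gt_of_ne hne with h | h
      · exact aux i j h rfl
      · exact aux j i h (Finset.pair_comm _ _)

lemma xi_pred_card {r : ℕ} (m : Fin r → ℕ) (a : ℕ) (u : {x : Fin r → ℕ // xiVert m a x}) :
    Nat.card {v : {x : Fin r → ℕ // xiVert m a x} // xiArrow m v.1 u.1} = (xiT u.1).card := by
  have h1 : (xiT u.1).card = Nat.card {z // z ∈ xiT u.1} := by simp
  rw [h1]
  have hz : ∀ v : {v : {x : Fin r → ℕ // xiVert m a x} // xiArrow m v.1 u.1},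
      u.1 - v.1.1 ∈ xiT u.1 := by
    intro v
    obtain ⟨z, hz, h⟩ := (xiArrow_iff m v.1.1 u.1 u.2.1).1 v.2
    have e : u.1 - v.1.1 = z := by
      funext k
      have := congrFun h k
      simp only [Pi.add_apply, Pi.sub_apply] at this ⊢
      omega
    rw [e]
    simp only [xiT, mem_filter, mem_Iic]
    refine ⟨fun k => ?_, hz⟩
    have := congrFun h k
    simp only [Pi.add_apply] at this
    change z k ≤ u.1 k
    omega
  refine Nat.card_eq_of_bijective (fun v => ⟨u.1 - v.1.1, hz v⟩) ⟨?_, ?_⟩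
  · intro v w hvw
    obtain ⟨z, _, h⟩ := (xiArrow_iff m v.1.1 u.1 u.2.1).1 v.2
    obtain ⟨z', _, h'⟩ := (xiArrow_iff m w.1.1 u.1 u.2.1).1 w.2
    have h3 : u.1 - v.1.1 = u.1 - w.1.1 := congrArg Subtype.val hvw
    apply Subtype.ext
    apply Subtype.ext
    funext k
    have e1 := congrFun h k
    have e2 := congrFun h' k
    have e3 := congrFun h3 k
    simp only [Pi.add_apply, Pi.sub_apply] at e1 e2 e3
    omega
  · rintro ⟨z, hzm⟩
    simp only [xiT, mem_filter, mem_Iic] at hzm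
    obtain ⟨hle, hs⟩ := hzm
    have hsum : ∑ i, (u.1 - z) i + ∑ i, z i = ∑ i, u.1 i := by
      rw [← Finset.sum_add_distrib]
      refine Finset.sum_congr rfl fun i _ => ?_
      have : z i ≤ u.1 i := hle i
      simp only [Pi.sub_apply]
      omega
    have hu := u.2.2
    refine ⟨⟨⟨u.1 - z, fun i => ?_, by omega⟩, ?_⟩, ?_⟩
    · have := u.2.1 i
      simp only [Pi.sub_apply]
      omega
    · rw [xiArrow_iff m _ u.1 u.2.1]
      exact ⟨z, hs, (tsub_add_cancel_of_le hle).symm⟩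
    · apply Subtype.ext
      exact tsub_tsub_cancel_of_le hle

lemma xi_arrow_sum {r : ℕ} (m x y : Fin r → ℕ) (hy : ∀ i, y i ≤ m i) (h : xiArrow m x y) :
    ∑ i, y i = ∑ i, x i + 2 := by
  obtain ⟨z, hz, rfl⟩ := (xiArrow_iff m x y hy).1 h
  simp [Finset.sum_add_distrib, hz]

lemma xi_exists_pred {r : ℕ} (m : Fin r → ℕ) (a : ℕ) (u : {x : Fin r → ℕ // xiVert m a x})
    (h : 2 ≤ ∑ i, u.1 i) : ∃ v : {x : Fin r → ℕ // xiVert m a x}, xiArrow m v.1 u.1 := by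
  by_contra hcon
  push Not at hcon
  have h1 := xi_pred_card m a u
  have : IsEmpty {v : {x : Fin r → ℕ // xiVert m a x} // xiArrow m v.1 u.1} :=
    ⟨fun v => hcon v.1 v.2⟩
  rw [Nat.card_of_isEmpty, xiT_card] at h1
  have h2 : (univ.filter (fun i => 2 ≤ u.1 i)).card = 0 := by omega
  have h3 : ∀ i, u.1 i ≤ 1 := by
    intro i
    by_contra hi
    rw [Finset.card_eq_zero] at h2
    have : i ∈ univ.filter (fun i => 2 ≤ u.1 i) := by simp; omega
    rw [h2] at this
    simp at this
  have h4 := xi_le_one u.1 h3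
  have h5 : 0 < (univ.filter (fun i => 1 ≤ u.1 i)).card.choose 2 :=
    Nat.choose_pos (by omega)
  omega

lemma xi_sum_le_one_iff {r : ℕ} (m : Fin r → ℕ) (a : ℕ) (u : {x : Fin r → ℕ // xiVert m a x}) :
    ∑ i, u.1 i ≤ 1 ↔ ∀ v : {x : Fin r → ℕ // xiVert m a x}, ¬ xiArrow m v.1 u.1 := by
  constructor
  · intro h v hv
    have := xi_arrow_sum m _ _ u.2.1 hv
    omega
  · intro h
    by_contra hc
    obtain ⟨v, hv⟩ := xi_exists_pred m a u (by omega)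
    exact h v hv

lemma xi_F_le_one {r r' : ℕ} (m : Fin r → ℕ) (m' : Fin r' → ℕ) (a a' : ℕ)
    (F : {x : Fin r → ℕ // xiVert m a x} ≃ {x : Fin r' → ℕ // xiVert m' a' x})
    (hF : ∀ u v, xiArrow m u.1 v.1 ↔ xiArrow m' (F u).1 (F v).1) (u) (h : ∑ i, u.1 i ≤ 1) :
    ∑ i, (F u).1 i ≤ 1 := by
  rw [xi_sum_le_one_iff] at h ⊢
  intro v hv
  obtain ⟨w, rfl⟩ := F.surjective v
  exact h w ((hF w u).2 hv)

lemma xi_symm {r r' : ℕ} (m : Fin r → ℕ) (m' : Fin r' → ℕ) (a a' : ℕ)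
    (F : {x : Fin r → ℕ // xiVert m a x} ≃ {x : Fin r' → ℕ // xiVert m' a' x})
    (hF : ∀ u v, xiArrow m u.1 v.1 ↔ xiArrow m' (F u).1 (F v).1) :
    ∀ u v, xiArrow m' u.1 v.1 ↔ xiArrow m (F.symm u).1 (F.symm v).1 := by
  intro u v
  rw [hF]
  simp

lemma xi_a {r r' : ℕ} (hr' : 2 ≤ r') (m : Fin r → ℕ) (m' : Fin r' → ℕ)
    (hm' : ∀ i, 1 ≤ m' i)
    (F : {x : Fin r → ℕ // xiVert m 0 x} ≃ {x : Fin r' → ℕ // xiVert m' 1 x})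
    (hF : ∀ u v, xiArrow m u.1 v.1 ↔ xiArrow m' (F u).1 (F v).1) : False := by
  have hv : ∀ i : Fin r', xiVert m' 1 (Pi.single i 1) := by
    intro i
    refine ⟨fun k => ?_, by simp⟩
    have := hm' k
    simp only [Pi.single_apply]
    split_ifs <;> omega
  have hz : ∀ i : Fin r', (F.symm ⟨_, hv i⟩).1 = 0 := by
    intro i
    have h1 := xi_F_le_one m' m 1 0 F.symm (xi_symm m m' 0 1 F hF) ⟨_, hv i⟩ (by simp)
    have h2 := (F.symm ⟨_, hv i⟩).2.2
    have h3 : ∑ k, (F.symm ⟨_, hv i⟩).1 k = 0 := by omega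
    rw [Finset.sum_eq_zero_iff] at h3
    funext k
    exact h3 k (mem_univ k)
  have h0 := F.symm.injective (Subtype.ext ((hz ⟨0, by omega⟩).trans (hz ⟨1, by omega⟩).symm))
  have h1 := congrFun (congrArg Subtype.val h0) ⟨0, by omega⟩
  simp [Pi.single_apply] at h1

lemma xi_F_sum {r r' : ℕ} (m : Fin r → ℕ) (m' : Fin r' → ℕ) (a : ℕ)
    (F : {x : Fin r → ℕ // xiVert m a x} ≃ {x : Fin r' → ℕ // xiVert m' a x})
    (hF : ∀ u v, xiArrow m u.1 v.1 ↔ xiArrow m' (F u).1 (F v).1) (n : ℕ) :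
    ∀ u, ∑ i, u.1 i = n → ∑ i, (F u).1 i = n := by
  induction n using Nat.strong_induction_on with
  | _ n ih =>
    intro u hu
    by_cases h : n ≤ 1
    · have h1 := xi_F_le_one m m' a a F hF u (by omega)
      have h2 := u.2.2
      have h3 := (F u).2.2
      omega
    · obtain ⟨v, hv⟩ := xi_exists_pred m a u (by omega)
      have h1 := xi_arrow_sum m _ _ u.2.1 hv
      have h2 := xi_arrow_sum m' _ _ (F u).2.1 ((hF v u).1 hv)
      have h3 := ih (n - 2) (by omega) v (by omega)
      omega

lemma xi_F_T {r r' : ℕ} (m : Fin r → ℕ) (m' : Fin r' → ℕ) (a : ℕ)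
    (F : {x : Fin r → ℕ // xiVert m a x} ≃ {x : Fin r' → ℕ // xiVert m' a x})
    (hF : ∀ u v, xiArrow m u.1 v.1 ↔ xiArrow m' (F u).1 (F v).1) (u) :
    (xiT (F u).1).card = (xiT u.1).card := by
  rw [← xi_pred_card m a u, ← xi_pred_card m' a (F u)]
  exact (Nat.card_congr (F.subtypeEquiv fun v => hF v u)).symm

/-- Vertices of size `n` with exactly `d` predecessors. -/
def xiS {r : ℕ} (m : Fin r → ℕ) (n d : ℕ) : Finset (Fin r → ℕ) :=
  (Finset.Iic m).filter (fun x => ∑ i, x i = n ∧ (xiT x).card = d)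

/-- Vertices of size `n`. -/
def xiL {r : ℕ} (m : Fin r → ℕ) (n : ℕ) : Finset (Fin r → ℕ) :=
  (Finset.Iic m).filter (fun x => ∑ i, x i = n)

lemma xiS_le {r r' : ℕ} (m : Fin r → ℕ) (m' : Fin r' → ℕ) (a : ℕ)
    (F : {x : Fin r → ℕ // xiVert m a x} ≃ {x : Fin r' → ℕ // xiVert m' a x})
    (hF : ∀ u v, xiArrow m u.1 v.1 ↔ xiArrow m' (F u).1 (F v).1) (n d : ℕ) (hn : n % 2 = a) :
    (xiS m n d).card ≤ (xiS m' n d).card := by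
  have hv : ∀ x ∈ xiS m n d, xiVert m a x := by
    intro x hx
    simp only [xiS, mem_filter, mem_Iic] at hx
    exact ⟨hx.1, by rw [hx.2.1, hn]⟩
  classical
  refine Finset.card_le_card_of_injOn
    (fun x => if h : xiVert m a x then (F ⟨x, h⟩).1 else 0) ?_ ?_
  · intro x hx
    have h := hv x hx
    simp only [h, dif_pos]
    simp only [xiS, coe_filter, mem_Iic, Set.mem_ofPred_eq, mem_filter] at hx ⊢
    exact ⟨(F ⟨x, h⟩).2.1, xi_F_sum m m' a F hF n ⟨x, h⟩ hx.2.1,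
      (xi_F_T m m' a F hF ⟨x, h⟩).trans hx.2.2⟩
  · intro x hx y hy hxy
    have h := hv x hx
    have h' := hv y hy
    simp only [h, h', dif_pos] at hxy
    exact congrArg Subtype.val (F.injective (Subtype.ext hxy))

lemma xiL_le {r r' : ℕ} (m : Fin r → ℕ) (m' : Fin r' → ℕ) (a : ℕ)
    (F : {x : Fin r → ℕ // xiVert m a x} ≃ {x : Fin r' → ℕ // xiVert m' a x})
    (hF : ∀ u v, xiArrow m u.1 v.1 ↔ xiArrow m' (F u).1 (F v).1) (n : ℕ) (hn : n % 2 = a) :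
    (xiL m n).card ≤ (xiL m' n).card := by
  have hv : ∀ x ∈ xiL m n, xiVert m a x := by
    intro x hx
    simp only [xiL, mem_filter, mem_Iic] at hx
    exact ⟨hx.1, by rw [hx.2, hn]⟩
  classical
  refine Finset.card_le_card_of_injOn
    (fun x => if h : xiVert m a x then (F ⟨x, h⟩).1 else 0) ?_ ?_
  · intro x hx
    have h := hv x hx
    simp only [h, dif_pos]
    simp only [xiL, coe_filter, mem_Iic, Set.mem_ofPred_eq, mem_filter] at hx ⊢
    exact ⟨(F ⟨x, h⟩).2.1, xi_F_sum m m' a F hF n ⟨x, h⟩ hx.2⟩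
  · intro x hx y hy hxy
    have h := hv x hx
    have h' := hv y hy
    simp only [h, h', dif_pos] at hxy
    exact congrArg Subtype.val (F.injective (Subtype.ext hxy))

/-- Number of coordinates that are at least `t`. -/
def xiN {r : ℕ} (m : Fin r → ℕ) (t : ℕ) : ℕ := (univ.filter (fun i => t ≤ m i)).card

lemma xiN_le {r : ℕ} (m : Fin r → ℕ) (t : ℕ) : xiN m t ≤ r := by
  have := Finset.card_filter_le (univ : Finset (Fin r)) (fun i => t ≤ m i)
  simpa [xiN] using this

lemma xiN_one {r : ℕ} (m : Fin r → ℕ) (hm : ∀ i, 1 ≤ m i) : xiN m 1 = r := by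
  simp [xiN, hm]

lemma xiL_two {r : ℕ} (m : Fin r → ℕ) (hm : ∀ i, 1 ≤ m i) :
    (xiL m 2).card = xiN m 2 + r.choose 2 := by
  have h := xiT_card m
  change (xiL m 2).card = xiN m 2 + (xiN m 1).choose 2 at h
  rwa [xiN_one m hm] at h

lemma xi_single_le {r : ℕ} (m : Fin r → ℕ) (i : Fin r) (n : ℕ) (h : n ≤ m i) :
    (Pi.single i n : Fin r → ℕ) ≤ m := by
  intro k
  simp only [Pi.single_apply]
  split_ifs with hk
  · subst hk; exact h
  · exact Nat.zero_le _

lemma xi_single_inj {r : ℕ} (n : ℕ) (hn : 1 ≤ n) :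
    Function.Injective (fun i : Fin r => (Pi.single i n : Fin r → ℕ)) := by
  intro i j hij
  have := congrFun hij i
  by_contra hne
  simp [Pi.single_apply, hne] at this
  omega

lemma xiL_one {r : ℕ} (m : Fin r → ℕ) (hm : ∀ i, 1 ≤ m i) : (xiL m 1).card = r := by
  have h : xiL m 1 = univ.image (fun i => (Pi.single i 1 : Fin r → ℕ)) := by
    ext x
    simp only [xiL, mem_filter, mem_Iic, mem_image, mem_univ, true_and]
    constructor
    · rintro ⟨_, h⟩
      have : ∃ i, 1 ≤ x i := by
        by_contra hc
        push Not at hc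
        have : ∑ i, x i = 0 := Finset.sum_eq_zero fun i _ => by have := hc i; omega
        omega
      obtain ⟨i, hi⟩ := this
      exact ⟨i, (xi_eq_single x i 1 h hi).symm⟩
    · rintro ⟨i, rfl⟩
      exact ⟨xi_single_le m i 1 (hm i), by simp⟩
  rw [h, Finset.card_image_of_injective _ (xi_single_inj 1 le_rfl)]
  simp

lemma xi_p_le {r : ℕ} (x : Fin r → ℕ) : xiN x 2 ≤ xiN x 1 := by
  refine Finset.card_le_card fun i hi => ?_
  simp only [mem_filter, mem_univ, true_and] at hi ⊢
  omega

lemma xi_T_card' {r : ℕ} (x : Fin r → ℕ) : (xiT x).card = xiN x 2 + (xiN x 1).choose 2 := xiT_card x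

lemma xi_q_zero {r : ℕ} (x : Fin r → ℕ) (h : xiN x 2 = 0) : ∑ i, x i = xiN x 1 := by
  apply xi_le_one
  intro i
  by_contra hi
  rw [xiN, Finset.card_eq_zero] at h
  have : i ∈ univ.filter (fun i => 2 ≤ x i) := by simp; omega
  rw [h] at this
  simp at this

lemma xi_supp_sum {r : ℕ} (x : Fin r → ℕ) :
    ∑ i ∈ univ.filter (fun i => 1 ≤ x i), x i = ∑ i, x i := by
  apply Finset.sum_subset (Finset.subset_univ _)
  intro i _ hi
  simp at hi
  exact hi

lemma xi_N_single {r : ℕ} (i : Fin r) (n t : ℕ) (ht : 1 ≤ t) (h : t ≤ n) :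
    xiN (Pi.single i n : Fin r → ℕ) t = 1 := by
  rw [xiN, Finset.card_eq_one]
  refine ⟨i, ?_⟩
  ext k
  simp only [mem_filter, mem_univ, true_and, mem_singleton, Pi.single_apply]
  split_ifs with hk <;> simp [hk] <;> omega

lemma xiS_one {r : ℕ} (m : Fin r → ℕ) (n : ℕ) (hn : 3 ≤ n) : (xiS m n 1).card = xiN m n := by
  have h : xiS m n 1 = (univ.filter (fun i => n ≤ m i)).image
      (fun i => (Pi.single i n : Fin r → ℕ)) := by
    ext x
    simp only [xiS, mem_filter, mem_Iic, mem_image, mem_univ, true_and]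
    constructor
    · rintro ⟨hx, hs, hc⟩
      rw [xi_T_card'] at hc
      have hp : xiN x 1 = 1 := by
        have h1 := xi_p_le x
        have h3 := xi_q_zero x
        by_contra hne
        have h2 : 2 ≤ xiN x 1 := by
          rcases Nat.lt_or_ge (xiN x 1) 2 with h | h
          · have : xiN x 1 = 0 := by omega
            have h4 := h3 (by omega)
            omega
          · exact h
        have h5 : 0 < (xiN x 1).choose 2 := Nat.choose_pos h2
        have h6 := h3 (by omega)
        have h7 := Nat.choose_le_choose 2 (show 3 ≤ xiN x 1 by omega)
        have h8 : Nat.choose 3 2 = 3 := rfl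
        omega
      obtain ⟨i, hi⟩ := Finset.card_eq_one.1 hp
      have h1 := xi_supp_sum x
      rw [hi, Finset.sum_singleton] at h1
      have h2 := xi_eq_single x i n hs (by omega)
      refine ⟨i, ?_, h2.symm⟩
      have : x i ≤ m i := hx i
      omega
    · rintro ⟨i, hi, rfl⟩
      refine ⟨xi_single_le m i n hi, by simp, ?_⟩
      rw [xi_T_card', xi_N_single i n 2 (by omega) (by omega),
        xi_N_single i n 1 (by omega) (by omega)]
      rfl
  rw [h, Finset.card_image_of_injective _ (xi_single_inj n (by omega))]
  rfl

lemma xi_two_val {r : ℕ} (i j k : Fin r) (n : ℕ) (hij : i ≠ j) :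
    (Pi.single i n + Pi.single j 1 : Fin r → ℕ) k = if k = i then n else if k = j then 1 else 0 := by
  simp only [Pi.add_apply, Pi.single_apply]
  by_cases h : k = i
  · subst h; simp [hij]
  · simp [h]

lemma xiS_two {r : ℕ} (m : Fin r → ℕ) (hm : ∀ i, 1 ≤ m i) (n : ℕ) (hn : 2 ≤ n) :
    (xiS m (n + 1) 2).card = xiN m n * (r - 1) := by
  classical
  have h : xiS m (n + 1) 2 =
      ((univ.filter (fun i => n ≤ m i)).sigma (fun i => univ.erase i)).image
      (fun p => (Pi.single p.1 n + Pi.single p.2 1 : Fin r → ℕ)) := by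
    ext x
    simp only [xiS, mem_filter, mem_Iic, mem_image, mem_univ, true_and, mem_sigma, mem_erase,
      and_true]
    constructor
    · rintro ⟨hx, hs, hc⟩
      rw [xi_T_card'] at hc
      have h1 := xi_p_le x
      have h3 := xi_q_zero x
      have hp : xiN x 1 = 2 := by
        rcases Nat.lt_or_ge (xiN x 1) 3 with h | h
        · have : xiN x 1 = 0 ∨ xiN x 1 = 1 ∨ xiN x 1 = 2 := by omega
          rcases this with h | h | h
          · rw [h] at hc; simp at hc; omega
          · rw [h] at hc; simp at hc; omega
          · exact h
        · have h7 := Nat.choose_le_choose 2 h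
          have h8 : Nat.choose 3 2 = 3 := rfl
          omega
      have hq : xiN x 2 = 1 := by
        rw [hp] at hc
        simp at hc
        omega
      obtain ⟨i, hi⟩ := Finset.card_eq_one.1 hq
      have hi2 : i ∈ univ.filter (fun i => 2 ≤ x i) := by rw [hi]; simp
      simp only [mem_filter, mem_univ, true_and] at hi2
      have himem : i ∈ univ.filter (fun i => 1 ≤ x i) := by simp; omega
      have hcard : ((univ.filter (fun i => 1 ≤ x i)).erase i).card = 1 := by
        rw [Finset.card_erase_of_mem himem]
        change xiN x 1 - 1 = 1
        omega
      obtain ⟨j, hj⟩ := Finset.card_eq_one.1 hcard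
      have hj2 : j ∈ (univ.filter (fun i => 1 ≤ x i)).erase i := by rw [hj]; simp
      simp only [mem_erase, mem_filter, mem_univ, true_and] at hj2
      have hj1 : x j = 1 := by
        by_contra hne
        have : j ∈ univ.filter (fun i => 2 ≤ x i) := by simp; omega
        rw [hi] at this
        simp at this
        exact hj2.1 this
      have hsum := xi_supp_sum x
      rw [← Finset.sum_erase_add _ _ himem, hj, Finset.sum_singleton] at hsum
      have hxi : x i = n := by omega
      refine ⟨⟨i, j⟩, ⟨?_, hj2.1⟩, ?_⟩
      · have : x i ≤ m i := hx i
        simp only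
        omega
      · funext k
        simp only
        rw [xi_two_val i j k n (Ne.symm hj2.1)]
        split_ifs with h4 h5
        · rw [h4, hxi]
        · rw [h5, hj1]
        · by_contra hne
          have : k ∈ (univ.filter (fun i => 1 ≤ x i)).erase i := by simp [h4]; omega
          rw [hj] at this
          simp at this
          exact h5 this
    · rintro ⟨⟨i, j⟩, ⟨hi, hj⟩, rfl⟩
      simp only at hi hj ⊢
      refine ⟨fun k => ?_, by simp [Finset.sum_add_distrib], ?_⟩
      · rw [xi_two_val i j k n hj.symm]
        have := hm k
        split_ifs with h4
        · rw [h4]; exact hi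
        · exact this
        · exact Nat.zero_le _
      · have e2 : xiN (Pi.single i n + Pi.single j 1 : Fin r → ℕ) 2 = 1 := by
          rw [xiN, Finset.card_eq_one]
          refine ⟨i, ?_⟩
          ext k
          simp only [mem_filter, mem_univ, true_and, mem_singleton, xi_two_val i j k n hj.symm]
          split_ifs with h1 h2 <;> simp [h1] <;> omega
        have e1 : xiN (Pi.single i n + Pi.single j 1 : Fin r → ℕ) 1 = 2 := by
          rw [xiN, Finset.card_eq_two]
          refine ⟨i, j, hj.symm, ?_⟩
          ext k
          simp only [mem_filter, mem_univ, true_and, mem_singleton, mem_insert,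
            xi_two_val i j k n hj.symm]
          split_ifs with h1 h2 <;> simp [h1] <;> first | omega | assumption
        rw [xi_T_card', e1, e2]
        rfl
  rw [h, Finset.card_image_of_injOn, Finset.card_sigma]
  · simp [xiN]
  · rintro ⟨i, j⟩ hp ⟨k, l⟩ hp' heq
    simp only [coe_sigma, Set.mem_sigma_iff, mem_coe, mem_erase, mem_univ, and_true] at hp hp'
    simp only at heq
    have f := fun t => congrFun heq t
    simp only [xi_two_val i j _ n hp.2.symm, xi_two_val k l _ n hp'.2.symm] at f
    have f1 := f i
    have hik : i = k := by
      by_contra hne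
      simp [hne] at f1
      split_ifs at f1 <;> omega
    subst hik
    have f2 := f j
    have hjl : j = l := by
      by_contra hne
      simp [hne, hp.2] at f2
    subst hjl
    rfl

lemma xi_lt_N {r : ℕ} (m : Fin r → ℕ) (hdec : ∀ i j : Fin r, i ≤ j → m j ≤ m i) (t : ℕ)
    (i : Fin r) : t ≤ m i ↔ i.val < xiN m t := by
  constructor
  · intro h
    have : (Finset.Iic i) ⊆ univ.filter (fun i => t ≤ m i) := by
      intro k hk
      simp only [mem_Iic, mem_filter, mem_univ, true_and] at hk ⊢
      exact h.trans (hdec k i hk)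
    have := Finset.card_le_card this
    rw [Fin.card_Iic] at this
    exact this
  · intro h
    by_contra hc
    have : univ.filter (fun i => t ≤ m i) ⊆ Finset.Iio i := by
      intro k hk
      simp only [mem_Iio, mem_filter, mem_univ, true_and] at hk ⊢
      by_contra hki
      exact hc (hk.trans (hdec i k (not_lt.1 hki)))
    have := Finset.card_le_card this
    rw [Fin.card_Iio] at this
    exact absurd h (not_lt.2 this)

lemma xi_r_le {r r' : ℕ} (hr : 2 ≤ r) (m : Fin r → ℕ) (m' : Fin r' → ℕ)
    (hm : ∀ i, 1 ≤ m i) (hm' : ∀ i, 1 ≤ m' i)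
    (F : {x : Fin r → ℕ // xiVert m 0 x} ≃ {x : Fin r' → ℕ // xiVert m' 0 x})
    (hF : ∀ u v, xiArrow m u.1 v.1 ↔ xiArrow m' (F u).1 (F v).1) : r' ≤ r := by
  by_contra hlt
  have h1 := xiL_le m' m 0 F.symm (xi_symm m m' 0 0 F hF) 2 rfl
  rw [xiL_two m hm, xiL_two m' hm'] at h1
  have h2 := Nat.choose_le_choose 2 (show r + 1 ≤ r' by omega)
  have h3 : (r + 1).choose 2 = r + r.choose 2 := by
    rw [Nat.choose_succ_succ]; simp
  have h4 := xiN_le m 2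
  have h5 : xiN m 2 = r := by omega
  have h6 : xiN m' 2 = 0 := by omega
  have h7 : ∀ i, 2 ≤ m i := by
    intro i
    have h8 : (univ.filter (fun i => 2 ≤ m i)) = univ := by
      rw [← Finset.card_eq_iff_eq_univ, Fintype.card_fin]; exact h5
    have : i ∈ univ.filter (fun i => 2 ≤ m i) := by rw [h8]; simp
    simpa using this
  let s : Finset (Fin r) := {⟨0, by omega⟩, ⟨1, by omega⟩}
  have hs : s.card = 2 := by
    apply Finset.card_pair; simp
  let x : Fin r → ℕ := fun k => if k ∈ s then 2 else 0
  have hsum : ∑ i, x i = 4 := by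
    simp [x, hs]
  have hx : xiVert m 0 x := by
    refine ⟨fun k => ?_, by rw [hsum]⟩
    have := h7 k
    simp only [x]
    split_ifs <;> omega
  have hN : ∀ t, 1 ≤ t → t ≤ 2 → xiN x t = 2 := by
    intro t h1 h2
    rw [← hs, xiN]
    congr 1
    ext k
    simp only [mem_filter, mem_univ, true_and, x]
    split_ifs with h <;> simp [h] <;> omega
  have hT := xi_F_T m m' 0 F hF ⟨x, hx⟩
  have hS := xi_F_sum m m' 0 F hF 4 ⟨x, hx⟩ hsum
  have hv := (F ⟨x, hx⟩).2.1
  generalize (F ⟨x, hx⟩).1 = y at hT hS hv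
  have hy : xiN y 2 = 0 := by
    apply Nat.eq_zero_of_le_zero
    rw [← h6]
    refine Finset.card_le_card fun i hi => ?_
    simp only [mem_filter, mem_univ, true_and] at hi ⊢
    exact hi.trans (hv i)
  have hy1 := xi_q_zero y hy
  rw [xi_T_card', xi_T_card', hN 1 (by omega) (by omega), hN 2 (by omega) (by omega), hy,
    ← hy1, hS] at hT
  exact absurd hT (by decide)

/-- for weakly decreasing positive tuples `m, m'` of lengths `r, r' ≥ 2` and
`a, a' ∈ {0, 1}` with `(a, m) ≠ (1, (1,1)) ≠ (a', m')`, an isomorphism of quivers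
`Ξ_a(m) ≅ Ξ_{a'}(m')` forces `a = a'`, `r = r'` and `m = m'`. -/
theorem stmt_7 (r r' : ℕ) (hr : 2 ≤ r) (hr' : 2 ≤ r')
    (m : Fin r → ℕ) (m' : Fin r' → ℕ) (hm : ∀ i, 1 ≤ m i) (hm' : ∀ i, 1 ≤ m' i)
    (hdec : ∀ i j : Fin r, i ≤ j → m j ≤ m i) (hdec' : ∀ i j : Fin r', i ≤ j → m' j ≤ m' i)
    (a a' : ℕ) (ha : a ≤ 1) (ha' : a' ≤ 1)
    (hex : ¬(a = 1 ∧ r = 2 ∧ ∀ i, m i = 1)) (hex' : ¬(a' = 1 ∧ r' = 2 ∧ ∀ i, m' i = 1))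
    (F : {x : Fin r → ℕ // xiVert m a x} ≃ {x : Fin r' → ℕ // xiVert m' a' x})
    (hF : ∀ u v, xiArrow m u.1 v.1 ↔ xiArrow m' (F u).1 (F v).1) :
    a = a' ∧ ∃ h : r = r', ∀ i : Fin r, m i = m' (Fin.cast h i) := by
  have haa : a = a' := by
    have h1 : a = 0 ∨ a = 1 := by omega
    have h2 : a' = 0 ∨ a' = 1 := by omega
    rcases h1 with rfl | rfl <;> rcases h2 with rfl | rfl
    · rfl
    · exact (xi_a hr' m m' hm' F hF).elim
    · exact (xi_a hr m' m hm F.symm (xi_symm m m' _ _ F hF)).elim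
    · rfl
  subst haa
  have hF' := xi_symm m m' a a F hF
  have hrr : r = r' := by
    have h1 : a = 0 ∨ a = 1 := by omega
    rcases h1 with rfl | rfl
    · exact le_antisymm (xi_r_le hr' m' m hm' hm F.symm hF') (xi_r_le hr m m' hm hm' F hF)
    · have h1 := xiL_le m m' 1 F hF 1 rfl
      have h2 := xiL_le m' m 1 F.symm hF' 1 rfl
      rw [xiL_one m hm, xiL_one m' hm'] at h1 h2
      omega
  subst hrr
  refine ⟨rfl, rfl, ?_⟩
  have hS : ∀ n d, n % 2 = a → (xiS m n d).card = (xiS m' n d).card := fun n d hn =>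
    le_antisymm (xiS_le m m' a F hF n d hn) (xiS_le m' m a F.symm hF' n d hn)
  have hN : ∀ t, xiN m t = xiN m' t := by
    intro t
    rcases Nat.eq_zero_or_pos t with rfl | ht
    · simp [xiN]
    by_cases h1 : t = 1
    · subst h1; rw [xiN_one m hm, xiN_one m' hm']
    by_cases hp : t % 2 = a
    · by_cases h2 : t = 2
      · subst h2
        have h1 := xiL_le m m' a F hF 2 hp
        have h2 := xiL_le m' m a F.symm hF' 2 hp
        rw [xiL_two m hm, xiL_two m' hm'] at h1 h2
        omega
      · have := hS t 1 hp
        rwa [xiS_one m t (by omega), xiS_one m' t (by omega)] at this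
    · have := hS (t + 1) 2 (by omega)
      rw [xiS_two m hm t (by omega), xiS_two m' hm' t (by omega)] at this
      exact Nat.eq_of_mul_eq_mul_right (by omega) this
  intro i
  have h1 := xi_lt_N m hdec
  have h2 := xi_lt_N m' hdec'
  apply le_antisymm
  · exact (h2 _ i).2 (hN _ ▸ (h1 _ i).1 le_rfl)
  · exact (h1 _ i).2 ((hN _).symm ▸ (h2 _ i).1 le_rfl)
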